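/- For every i ≥ 1 and all integers t, r, s with 0 ≤ t < a_{2i+1}, 0 ≤ r < k_{2i}, 0 ≤ s < h_{2i}, one has p₁^{k_{2i−1}+t·k_{2i}+r}·p₂^{s} < p₁^{r}·p₂^{h_{2i−1}+t·h_{2i}+s}, and there is no element of S strictly between these two numbers; that is, p₁^{r}·p₂^{h_{2i−1}+t·h_{2i}+s} is the immediate successor of p₁^{k_{2i−1}+t·k_{2i}+r}·p₂^{s} in S. -/

import Mathlib

theorem pow_mul_pow_lt_iff_log_div_log {p q : ℕ} (hp : 0 < p) (hq : 1 < q) (x y b c : ℕ) :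
    p ^ x * q ^ y < p ^ b * q ^ c ↔
      (x : ℝ) * (Real.log p / Real.log q) + y < b * (Real.log p / Real.log q) + c := by
  have hp' : (0 : ℝ) < p := by exact_mod_cast hp
  have hq' : (0 : ℝ) < q := by exact_mod_cast (zero_lt_one.trans hq)
  have hlog : 0 < Real.log q := Real.log_pos (by exact_mod_cast hq)
  have key : ∀ m n : ℕ, Real.log ((p : ℝ) ^ m * (q : ℝ) ^ n) =
      (m * (Real.log p / Real.log q) + n) * Real.log q := by
    intro m n
    rw [Real.log_mul (by positivity) (by positivity), Real.log_pow, Real.log_pow]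
    field_simp
  rw [← Nat.cast_lt (α := ℝ)]
  push_cast
  rw [← Real.log_lt_log_iff (by positivity) (by positivity), key, key]
  exact mul_lt_mul_iff_left₀ hlog

/-- If `(K, H)` and `(k, h)` form a unimodular pair lying on opposite sides of the line of slope
`γ`, then no lattice point of the quadrant `u > -k`, `v > -h` has `γ * u + v` strictly between
`γ * K` and `H`. -/
theorem not_between_of_unimodular {γ : ℝ} {K H k h u v : ℤ}
    (hK : 0 ≤ K) (hH : 0 ≤ H) (hk : 0 ≤ k) (hh : 0 ≤ h) (hdet : H * k - K * h = 1)
    (hKH : γ * K < H) (hkh : (h : ℝ) < γ * k) (hu : -k < u) (hv : -h < v) :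
    ¬(γ * K < γ * u + v ∧ γ * u + v < H) := by
  rintro ⟨h1, h2⟩
  obtain ⟨m, hm⟩ : ∃ m, m = -((u - K) * h + v * k) := ⟨_, rfl⟩
  obtain ⟨n, hn⟩ : ∃ n, n = (u - K) * H + v * K := ⟨_, rfl⟩
  have hu' : u = (m + 1) * K + n * k := by
    subst hm hn; linear_combination (K - u) * hdet
  have hv' : v = -(m * H + n * h) := by
    subst hm hn; linear_combination (-v) * hdet
  clear hm hn
  subst hu' hv'
  push_cast at h1 h2
  have e1 : (m : ℝ) * (H - γ * K) < n * (γ * k - h) := by linarith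
  have e2 : (n : ℝ) * (γ * k - h) < (m + 1) * (H - γ * K) := by linarith
  rcases lt_or_ge 0 n with hn | hn
  · have hn' : (0 : ℝ) < n := by exact_mod_cast hn
    have hm : (0 : ℝ) < m + 1 :=
      pos_of_mul_pos_left ((mul_pos hn' (sub_pos.2 hkh)).trans e2) (sub_pos.2 hKH).le
    have hm' : 0 < m + 1 := by exact_mod_cast hm
    nlinarith [mul_nonneg (show 0 ≤ m by lia) hH, mul_nonneg (show 0 ≤ n - 1 by lia) hh]
  · have hn' : (n : ℝ) ≤ 0 := by exact_mod_cast hn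
    have hm : (m : ℝ) < 0 := by
      by_contra! hm
      nlinarith [mul_nonneg hm (sub_pos.2 hKH).le,
        mul_nonneg (neg_nonneg.2 hn') (sub_pos.2 hkh).le]
    have hm' : m < 0 := by exact_mod_cast hm
    rcases eq_or_lt_of_le hn with rfl | hn0
    · have hm1 : (m : ℝ) + 1 ≤ 0 := by exact_mod_cast (show m + 1 ≤ 0 by lia)
      push_cast at e2
      nlinarith [mul_nonneg (neg_nonneg.2 hm1) (sub_pos.2 hKH).le]
    · nlinarith [mul_nonneg (show 0 ≤ -(m + 1) by lia) hK,
        mul_nonneg (show 0 ≤ -(n + 1) by lia) hk]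

theorem irrational_and_pos_of_gauss_iterate {a : ℕ → ℕ} {β : ℕ → ℝ} (hirr : Irrational (β 0))
    (hpos : 0 < β 0) (hfloor : ∀ i, (a (i + 1) : ℤ) = ⌊1 / β i⌋)
    (hrec : ∀ i, β (i + 1) = 1 / β i - (a (i + 1) : ℝ)) (n : ℕ) :
    Irrational (β n) ∧ 0 < β n := by
  induction n with
  | zero => exact ⟨hirr, hpos⟩
  | succ n ih =>
    have hi : Irrational (β (n + 1)) := by
      rw [hrec, one_div]
      exact ih.1.inv.sub_natCast _
    refine ⟨hi, lt_of_le_of_ne ?_ hi.ne_zero.symm⟩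
    rw [hrec, sub_nonneg, ← Int.cast_natCast, hfloor]
    exact Int.floor_le _

theorem signed_error_pos {a h k : ℕ → ℕ} {β : ℕ → ℝ} (hβ : ∀ n, 0 < β n)
    (hrec : ∀ i, β (i + 1) = 1 / β i - (a (i + 1) : ℝ))
    (hh0 : h 0 = 0) (hk0 : k 0 = 1) (hh1 : h 1 = 1) (hk1 : k 1 = a 1)
    (hhrec : ∀ i, h (i + 2) = a (i + 2) * h (i + 1) + h i)
    (hkrec : ∀ i, k (i + 2) = a (i + 2) * k (i + 1) + k i) (n : ℕ) :
    0 < (-1) ^ n * (β 0 * k n - h n) := by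
  suffices H : 0 < (-1) ^ n * (β 0 * k n - h n) ∧
      (-1) ^ (n + 1) * (β 0 * k (n + 1) - h (n + 1)) =
        β (n + 1) * ((-1) ^ n * (β 0 * k n - h n)) from H.1
  induction n with
  | zero =>
    have := hβ 0
    refine ⟨by simpa [hh0, hk0] using this, ?_⟩
    simp only [zero_add, hh0, hk0, hh1, hk1, hrec 0]
    push_cast
    field_simp
    ring
  | succ n ih =>
    have hpos := hβ (n + 1)
    refine ⟨ih.2 ▸ mul_pos hpos ih.1, ?_⟩
    have e : (-1) ^ n * (β 0 * k n - h n) =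
        1 / β (n + 1) * ((-1) ^ (n + 1) * (β 0 * k (n + 1) - h (n + 1))) := by
      rw [ih.2]; field_simp
    rw [hrec (n + 1), hhrec, hkrec]
    push_cast
    linear_combination e

theorem convergent_det {a h k : ℕ → ℕ}
    (hh0 : h 0 = 0) (hk0 : k 0 = 1) (hh1 : h 1 = 1)
    (hhrec : ∀ i, h (i + 2) = a (i + 2) * h (i + 1) + h i)
    (hkrec : ∀ i, k (i + 2) = a (i + 2) * k (i + 1) + k i) (n : ℕ) :
    (h (n + 1) * k n - k (n + 1) * h n : ℤ) = (-1) ^ n := by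
  induction n with
  | zero => simp [hh0, hk0, hh1]
  | succ n ih =>
    rw [hhrec, hkrec]
    push_cast
    linear_combination -ih

/- Context: 1 < p1 < p2 naturals with γ = log p1 / log p2 irrational,
S = {p1^i * p2^j} the multiplicatively closed set generated by p1, p2,
γ = [0; a₁, a₂, …] its continued fraction (β i the tails), hᵢ/kᵢ its convergents. -/
theorem stmt_12 (p1 p2 : ℕ) (hp1 : 1 < p1) (hp12 : p1 < p2)
    (hγirr : Irrational (Real.log p1 / Real.log p2))
    (a h k : ℕ → ℕ) (β : ℕ → ℝ)
    (ha0 : a 0 = 0) (hapos : ∀ i, 1 ≤ i → 1 ≤ a i)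
    (hβ0 : β 0 = Real.log p1 / Real.log p2)
    (hfloor : ∀ i, (a (i + 1) : ℤ) = ⌊1 / β i⌋)
    (hβrec : ∀ i, β (i + 1) = 1 / β i - (a (i + 1) : ℝ))
    (hh0 : h 0 = 0) (hk0 : k 0 = 1) (hh1 : h 1 = 1) (hk1 : k 1 = a 1)
    (hhrec : ∀ i, h (i + 2) = a (i + 2) * h (i + 1) + h i)
    (hkrec : ∀ i, k (i + 2) = a (i + 2) * k (i + 1) + k i) :
    ∀ i t r s : ℕ, 1 ≤ i → t < a (2 * i + 1) → r < k (2 * i) → s < h (2 * i) →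
      p1 ^ (k (2 * i - 1) + t * k (2 * i) + r) * p2 ^ s
          < p1 ^ r * p2 ^ (h (2 * i - 1) + t * h (2 * i) + s) ∧
      ∀ b c : ℕ,
        ¬(p1 ^ (k (2 * i - 1) + t * k (2 * i) + r) * p2 ^ s < p1 ^ b * p2 ^ c ∧
          p1 ^ b * p2 ^ c < p1 ^ r * p2 ^ (h (2 * i - 1) + t * h (2 * i) + s)) := by
  intro i t r s hi ht hr hs
  obtain ⟨j, rfl⟩ : ∃ j, i = j + 1 := ⟨i - 1, by lia⟩
  rw [show 2 * (j + 1) - 1 = 2 * j + 1 by lia]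
  rw [show 2 * (j + 1) = 2 * j + 2 by ring] at *
  have hγpos : 0 < β 0 := by
    rw [hβ0]
    exact div_pos (Real.log_pos (by exact_mod_cast hp1))
      (Real.log_pos (by exact_mod_cast hp1.trans hp12))
  have hβ n := (irrational_and_pos_of_gauss_iterate (hβ0 ▸ hγirr) hγpos hfloor hβrec n).2
  have herr := signed_error_pos hβ hβrec hh0 hk0 hh1 hk1 hhrec hkrec
  have hε : (h (2 * j + 2) : ℝ) < β 0 * k (2 * j + 2) := by
    have := herr (2 * j + 2)
    rw [Even.neg_one_pow ⟨j + 1, by ring⟩] at this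
    linarith
  have hδ : β 0 * (k (2 * j + 1) + t * k (2 * j + 2)) < h (2 * j + 1) + t * h (2 * j + 2) := by
    have := herr (2 * j + 3)
    rw [Odd.neg_one_pow ⟨j + 1, by ring⟩, hhrec, hkrec] at this
    push_cast at this
    have hta : (t : ℝ) ≤ a (2 * j + 3) := by exact_mod_cast ht.le
    nlinarith [mul_nonneg (sub_nonneg.2 hta) (sub_pos.2 hε).le]
  have hdet := convergent_det hh0 hk0 hh1 hhrec hkrec (2 * j + 1)
  rw [Odd.neg_one_pow ⟨j, rfl⟩] at hdet
  have hlt := pow_mul_pow_lt_iff_log_div_log (zero_lt_one.trans hp1) (hp1.trans hp12)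
  simp only [← hβ0] at hlt
  refine ⟨(hlt _ _ _ _).2 (by push_cast; linarith), fun b c => ?_⟩
  rw [hlt, hlt]
  rintro ⟨h1, h2⟩
  push_cast at h1 h2
  refine not_between_of_unimodular (γ := β 0)
    (K := k (2 * j + 1) + t * k (2 * j + 2)) (H := h (2 * j + 1) + t * h (2 * j + 2))
    (k := k (2 * j + 2)) (h := h (2 * j + 2)) (u := (b : ℤ) - r) (v := (c : ℤ) - s)
    (by positivity) (by positivity) (by positivity) (by positivity)
    (by linear_combination -hdet) (by exact_mod_cast hδ) (by exact_mod_cast hε)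
    (by lia) (by lia) ⟨?_, ?_⟩ <;> push_cast <;> linarith
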